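/- arXiv:math/9909132 — 6 statements merged into one kernel-verified Lean document; each statement's English description precedes it below -/
import Mathlib

section
/- Let ψ be a wavelet in L²(ℝ) and let U be a unitary operator on L²(ℝ) such that Uⁿ ∈ C_ψ(D,T) for every n ∈ ℤ. Then for every i ∈ ℤ the function U^i ψ is a wavelet, and the wavelets U^i ψ (i ∈ ℤ) are pairwise core equivalent. -/
open MeasureTheory
open scoped ComplexInnerProductSpace

noncomputable section

/-- The Hilbert space `L²(ℝ)` of square-integrable complex functions. -/
abbrev H : Type := MeasureTheory.Lp ℂ 2 (MeasureTheory.volume : MeasureTheory.Measure ℝ)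

/-- The algebra of bounded operators on `L²(ℝ)`. -/
abbrev B : Type := H →L[ℂ] H

/-- `ψ` is a wavelet for the dilation `D` and translation `T` if
`{DʲTⁿψ : j, n ∈ ℤ}` is an orthonormal basis of `L²(ℝ)`. -/
def IsWavelet (D T : unitary B) (ψ : H) : Prop :=
  Orthonormal ℂ (fun p : ℤ × ℤ =>
    ((D ^ p.1 : unitary B) : B) (((T ^ p.2 : unitary B) : B) ψ)) ∧
  (Submodule.span ℂ (Set.range fun p : ℤ × ℤ =>
    ((D ^ p.1 : unitary B) : B) (((T ^ p.2 : unitary B) : B) ψ))).topologicalClosure = ⊤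

/-- The local commutant `C_ψ(D,T)`. -/
def localCommutant (D T : unitary B) (ψ : H) : Set B :=
  {V : B | ∀ n l : ℤ,
    V (((D ^ n : unitary B) : B) (((T ^ l : unitary B) : B) ψ)) =
      ((D ^ n : unitary B) : B) (((T ^ l : unitary B) : B) (V ψ))}

/-- The core space `V₀^ψ`: the closed linear span of `{DⁿTˡψ : n < 0, l ∈ ℤ}`. -/
def coreSpace (D T : unitary B) (ψ : H) : Submodule ℂ H :=
  (Submodule.span ℂ {x : H | ∃ n l : ℤ, n < 0 ∧
    x = ((D ^ n : unitary B) : B) (((T ^ l : unitary B) : B) ψ)}).topologicalClosure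

/-- Two wavelets `ψ, η` are core equivalent if there is a unitary
`S : V₀^ψ → V₀^η` intertwining the translation `T`: `S(Tx) = T(Sx)`. -/
def CoreEquivalent (D T : unitary B) (ψ η : H) : Prop :=
  ∃ S : (coreSpace D T ψ) ≃ₗᵢ[ℂ] (coreSpace D T η),
    ∀ x y : coreSpace D T ψ, (y : H) = (T : B) (x : H) →
      ((S y : H) = (T : B) (S x : H))

section Hilbert

variable {E : Type*} [NormedAddCommGroup E] [InnerProductSpace ℂ E]

theorem ContinuousLinearMap.mapsTo_topologicalClosure_span {A : E →L[ℂ] E} {s : Set E}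
    (h : ∀ g ∈ s, A g ∈ Submodule.span ℂ s) :
    ∀ x ∈ (Submodule.span ℂ s).topologicalClosure,
      A x ∈ (Submodule.span ℂ s).topologicalClosure := by
  have hle : Submodule.span ℂ s ≤ (Submodule.span ℂ s).comap (A : E →ₗ[ℂ] E) :=
    Submodule.span_le.2 h
  exact Submodule.topologicalClosure_mem_invtSubmodule hle

variable [CompleteSpace E]

theorem commute_starProjection_of_unitary (u : unitary (E →L[ℂ] E)) (K : Submodule ℂ E)
    [K.HasOrthogonalProjection] (h : ∀ x ∈ K, (u : E →L[ℂ] E) x ∈ K)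
    (h' : ∀ x ∈ K, ((u⁻¹ : unitary (E →L[ℂ] E)) : E →L[ℂ] E) x ∈ K) :
    Commute (u : E →L[ℂ] E) K.starProjection := by
  ext x
  refine (Submodule.eq_starProjection_of_mem_orthogonal
    (h _ (K.starProjection_apply_mem x)) ?_).symm
  change (u : E →L[ℂ] E) x - (u : E →L[ℂ] E) (K.starProjection x) ∈ Kᗮ
  rw [← map_sub, Submodule.mem_orthogonal]
  intro y hy
  have hu : (u : E →L[ℂ] E) (((u⁻¹ : unitary (E →L[ℂ] E)) : E →L[ℂ] E) y) = y :=
    congr($(mul_inv_cancel u).val y)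
  rw [← hu, Unitary.inner_map_map]
  exact (Submodule.mem_orthogonal _ _).1 (K.sub_starProjection_mem_orthogonal x) _ (h' y hy)

/-- A unitary that agrees with `V` on the closed span of `s` and is the identity on its orthogonal
complement commutes with `A` as soon as `V` commutes with `A` on `s`. -/
theorem exists_unitary_commute_eqOn (V A : unitary (E →L[ℂ] E)) (s : Set E)
    (hV : ∀ g ∈ s, (V : E →L[ℂ] E) g ∈ s)
    (hV' : ∀ g ∈ s, ((V⁻¹ : unitary (E →L[ℂ] E)) : E →L[ℂ] E) g ∈ s)
    (hA : ∀ g ∈ s, (A : E →L[ℂ] E) g ∈ s)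
    (hA' : ∀ g ∈ s, ((A⁻¹ : unitary (E →L[ℂ] E)) : E →L[ℂ] E) g ∈ s)
    (hVA : ∀ g ∈ s, (V : E →L[ℂ] E) ((A : E →L[ℂ] E) g) =
      (A : E →L[ℂ] E) ((V : E →L[ℂ] E) g)) :
    ∃ R : unitary (E →L[ℂ] E), (∀ g ∈ s, (R : E →L[ℂ] E) g = (V : E →L[ℂ] E) g) ∧
      ∀ x, (R : E →L[ℂ] E) ((A : E →L[ℂ] E) x) = (A : E →L[ℂ] E) ((R : E →L[ℂ] E) x) := by
  set K := (Submodule.span ℂ s).topologicalClosure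
  have : CompleteSpace K := (Submodule.isClosed_topologicalClosure _).completeSpace_coe
  have invariant (u : unitary (E →L[ℂ] E)) (h : ∀ g ∈ s, (u : E →L[ℂ] E) g ∈ s) :
      ∀ x ∈ K, (u : E →L[ℂ] E) x ∈ K :=
    ContinuousLinearMap.mapsTo_topologicalClosure_span fun g hg =>
      Submodule.subset_span (h g hg)
  have hVP := commute_starProjection_of_unitary V K (invariant V hV) (invariant V⁻¹ hV')
  have hAP := commute_starProjection_of_unitary A K (invariant A hA) (invariant A⁻¹ hA')
  have hPP : K.starProjection * K.starProjection = K.starProjection :=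
    K.isIdempotentElem_starProjection
  have hPs : star K.starProjection = K.starProjection := isSelfAdjoint_starProjection K
  have hVsP : Commute (star (V : E →L[ℂ] E)) K.starProjection := by
    simpa [hPs] using hVP.star_star
  have hVV : star (V : E →L[ℂ] E) * V = 1 := Unitary.coe_star_mul_self V
  have hVV' : (V : E →L[ℂ] E) * star (V : E →L[ℂ] E) = 1 := Unitary.coe_mul_star_self V
  generalize hP : K.starProjection = P at hVP hAP hPP hPs hVsP
  have hR : (V : E →L[ℂ] E) * P + (1 - P) ∈ unitary (E →L[ℂ] E) := by
    rw [Unitary.mem_iff]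
    have hz : P * (1 - P) = 0 := by rw [mul_sub, hPP, mul_one, sub_self]
    have hz' : (1 - P) * P = 0 := by rw [sub_mul, hPP, one_mul, sub_self]
    have hq : (1 - P) * (1 - P) = 1 - P := by rw [mul_sub, hz', mul_one, sub_zero]
    have key (W W' : E →L[ℂ] E) (hc : Commute W' P) (h : W * W' = 1) :
        (W * P + (1 - P)) * (P * W' + (1 - P)) = 1 := by
      have h1 : W * P * (P * W') = P := by
        rw [mul_assoc, ← mul_assoc P P, hPP, ← hc.eq, ← mul_assoc, h, one_mul]
      rw [add_mul, mul_add, mul_add, h1, mul_assoc W, hz, ← mul_assoc (1 - P), hz', hq]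
      simp
    have hs : star ((V : E →L[ℂ] E) * P + (1 - P)) = P * star (V : E →L[ℂ] E) + (1 - P) := by
      simp [hPs]
    rw [hs]
    refine ⟨?_, key _ _ hVsP hVV'⟩
    rw [← hVsP.eq, hVP.eq]
    exact key _ _ hVP hVV
  refine ⟨⟨_, hR⟩, fun g hg => ?_, fun x => ?_⟩
  · have hg' : P g = g := by
      rw [← hP]
      exact Submodule.starProjection_eq_self_iff.2
        (Submodule.le_topologicalClosure _ (Submodule.subset_span hg))
    simp [hg']
  · have hPA : P ((A : E →L[ℂ] E) x) = (A : E →L[ℂ] E) (P x) := congr($(hAP.eq.symm) x)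
    have hcomm : (V : E →L[ℂ] E) ((A : E →L[ℂ] E) (P x)) =
        (A : E →L[ℂ] E) ((V : E →L[ℂ] E) (P x)) :=
      ContinuousLinearMap.eqOn_closure_span
        (f := (V : E →L[ℂ] E) * (A : E →L[ℂ] E)) (g := (A : E →L[ℂ] E) * (V : E →L[ℂ] E)) hVA
        (hP ▸ K.starProjection_apply_mem x)
    simp [hPA, hcomm]

end Hilbert

theorem translation_dilation {D T : unitary B}
    (hD : ∀ f : H, ⇑((D : B) f) =ᵐ[MeasureTheory.volume]
      fun x : ℝ => (Real.sqrt 2 : ℂ) * f (2 * x))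
    (hT : ∀ f : H, ⇑((T : B) f) =ᵐ[MeasureTheory.volume] fun x : ℝ => f (x + 1)) :
    T * D = D * T ^ 2 := by
  have hadd : Measure.QuasiMeasurePreserving (fun x : ℝ => x + 1) volume volume :=
    (measurePreserving_add_right volume 1).quasiMeasurePreserving
  have hmul : Measure.QuasiMeasurePreserving (fun x : ℝ => 2 * x) volume volume :=
    Measure.quasiMeasurePreserving_smul volume two_ne_zero
  ext f : 2
  change (T : B) ((D : B) f) = (D : B) ((T : B) ((T : B) f))
  refine Lp.ext ?_
  filter_upwards [hT ((D : B) f), hadd.ae (hD f), hD ((T : B) ((T : B) f)),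
    hmul.ae (hT ((T : B) f)), hmul.ae (hadd.ae (hT f))] with x h1 h2 h3 h4 h5
  rw [h1, h2, h3, h4, h5]
  ring_nf

theorem translation_zpow_dilation_pow {G : Type*} [Group G] {D T : G} (h : T * D = D * T ^ 2)
    (m : ℤ) (n : ℕ) : T ^ m * D ^ n = D ^ n * T ^ (2 ^ n * m) := by
  have h1 (m : ℤ) : T ^ m * D = D * T ^ (2 * m) := by
    rw [zpow_mul]
    exact (SemiconjBy.zpow_right (a := D) (x := T ^ (2 : ℤ)) (y := T) (by
      rw [SemiconjBy, h]; norm_cast) m).eq.symm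
  induction n generalizing m with
  | zero => simp
  | succ n ih =>
    rw [pow_succ', ← mul_assoc, h1, mul_assoc, ih, mul_assoc]
    congr 3
    ring

theorem translation_dilation_orbit {D T : unitary B} (h : T * D = D * T ^ 2) (m : ℤ) {n : ℤ}
    (hn : 0 ≤ n) (l : ℤ) (x : H) :
    ((T ^ m : unitary B) : B) (((D ^ n : unitary B) : B) (((T ^ l : unitary B) : B) x)) =
      ((D ^ n : unitary B) : B)
        (((T ^ (2 ^ n.toNat * m + l) : unitary B) : B) x) := by
  lift n to ℕ using hn
  have := translation_zpow_dilation_pow h m n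
  rw [Int.toNat_natCast, zpow_natCast, zpow_add]
  exact congr(($this : B) (((T ^ l : unitary B) : B) x))

theorem IsWavelet.mem_coreSpace_iff {D T : unitary B} {ψ : H} (hψ : IsWavelet D T ψ) {x : H} :
    x ∈ coreSpace D T ψ ↔ ∀ n l : ℤ, 0 ≤ n →
      inner ℂ (((D ^ n : unitary B) : B) (((T ^ l : unitary B) : B) ψ)) x = 0 := by
  have core_le {x : H} (hx : x ∈ coreSpace D T ψ) (n l : ℤ) (hn : 0 ≤ n) :
      inner ℂ (((D ^ n : unitary B) : B) (((T ^ l : unitary B) : B) ψ)) x = 0 := by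
    refine ContinuousLinearMap.eqOn_closure_span (g := 0)
      (f := innerSL ℂ (((D ^ n : unitary B) : B) (((T ^ l : unitary B) : B) ψ))) ?_ hx
    rintro _ ⟨m, k, hm, rfl⟩
    exact hψ.1.2 (i := (n, l)) (j := (m, k)) (by grind)
  refine ⟨core_le, fun hx => ?_⟩
  have : CompleteSpace (coreSpace D T ψ) :=
    (Submodule.isClosed_topologicalClosure _).completeSpace_coe
  set y := (coreSpace D T ψ).starProjection x
  have hmem : y ∈ coreSpace D T ψ := Submodule.starProjection_apply_mem _ x
  have hxy : x - y ∈ (coreSpace D T ψ)ᗮ := Submodule.sub_starProjection_mem_orthogonal x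
  have hzero : innerSL ℂ (x - y) = 0 := by
    ext z
    refine ContinuousLinearMap.eqOn_closure_span (f := innerSL ℂ (x - y)) (g := 0) ?_
      (hψ.2.ge (Submodule.mem_top (x := z)))
    rintro _ ⟨⟨n, l⟩, rfl⟩
    rcases lt_or_ge n 0 with hn | hn
    · exact (Submodule.mem_orthogonal' _ _).1 hxy _
        (Submodule.le_topologicalClosure _ (Submodule.subset_span ⟨n, l, hn, rfl⟩))
    · rw [innerSL_apply_apply, zero_apply, inner_eq_zero_symm, inner_sub_right,
        hx n l hn, core_le hmem n l hn, sub_zero]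
  have hself : inner ℂ (x - y) (x - y) = 0 := congr($hzero (x - y))
  rw [sub_eq_zero.1 (inner_self_eq_zero.1 hself)]
  exact hmem

theorem IsWavelet.map_of_mem_localCommutant {D T : unitary B} {ψ : H} (hψ : IsWavelet D T ψ)
    (V : unitary B) (hV : (V : B) ∈ localCommutant D T ψ) : IsWavelet D T ((V : B) ψ) := by
  set e := Unitary.linearIsometryEquiv V
  have hfam : (fun p : ℤ × ℤ =>
      ((D ^ p.1 : unitary B) : B) (((T ^ p.2 : unitary B) : B) ((V : B) ψ))) =
      e ∘ fun p : ℤ × ℤ => ((D ^ p.1 : unitary B) : B) (((T ^ p.2 : unitary B) : B) ψ) :=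
    funext fun p => (hV p.1 p.2).symm
  rw [IsWavelet, hfam]
  refine ⟨hψ.1.comp_linearIsometryEquiv e, ?_⟩
  have hdense : DenseRange (V : B) := e.surjective.denseRange
  have := hdense.topologicalClosure_map_submodule (f := (V : B)) hψ.2
  rwa [Submodule.map_span, ← Set.range_comp] at this

theorem coreEquivalent_of_unitary {D T : unitary B} {ψ η : H} (R : unitary B)
    (hR : ∀ x, (R : B) x ∈ coreSpace D T η ↔ x ∈ coreSpace D T ψ)
    (hRT : ∀ x, (R : B) ((T : B) x) = (T : B) ((R : B) x)) : CoreEquivalent D T ψ η := by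
  set e := Unitary.linearIsometryEquiv R
  have hmap : (coreSpace D T ψ).map (e.toLinearEquiv : H →ₗ[ℂ] H) = coreSpace D T η := by
    ext x
    obtain ⟨y, rfl⟩ := e.surjective x
    refine Iff.trans ?_ (hR y).symm
    rw [← e.coe_toLinearEquiv, Submodule.mem_map_equiv, LinearEquiv.symm_apply_apply]
  refine ⟨(e.submoduleMap (coreSpace D T ψ)).trans (LinearIsometryEquiv.ofEq _ _ hmap),
    fun x y hxy => ?_⟩
  change (R : B) y = (T : B) ((R : B) x)
  rw [hxy, hRT]

theorem coreEquivalent_zpow {D T U : unitary B} {ψ : H} (hTD : T * D = D * T ^ 2)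
    (hU : ∀ n : ℤ, ((U ^ n : unitary B) : B) ∈ localCommutant D T ψ)
    (hW : ∀ i : ℤ, IsWavelet D T (((U ^ i : unitary B) : B) ψ)) (i j : ℤ) :
    CoreEquivalent D T (((U ^ i : unitary B) : B) ψ) (((U ^ j : unitary B) : B) ψ) := by
  have hshift (k i n l : ℤ) :
      ((U ^ k : unitary B) : B) (((D ^ n : unitary B) : B)
        (((T ^ l : unitary B) : B) (((U ^ i : unitary B) : B) ψ))) =
      ((D ^ n : unitary B) : B)
        (((T ^ l : unitary B) : B) (((U ^ (k + i) : unitary B) : B) ψ)) := by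
    rw [← hU i n l, ← hU (k + i) n l, zpow_add]
    rfl
  set s : Set H := {x | ∃ i n l : ℤ, 0 ≤ n ∧ x = ((D ^ n : unitary B) : B)
    (((T ^ l : unitary B) : B) (((U ^ i : unitary B) : B) ψ))}
  have hUs (k : ℤ) : ∀ g ∈ s, ((U ^ k : unitary B) : B) g ∈ s := by
    rintro _ ⟨i, n, l, hn, rfl⟩
    exact ⟨k + i, n, l, hn, hshift k i n l⟩
  have hTs (m : ℤ) : ∀ g ∈ s, ((T ^ m : unitary B) : B) g ∈ s := by
    rintro _ ⟨i, n, l, hn, rfl⟩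
    exact ⟨i, n, _, hn, translation_dilation_orbit hTD m hn l _⟩
  obtain ⟨R, hRs, hRT⟩ := exists_unitary_commute_eqOn (U ^ (j - i)) T s (hUs _)
    (by rw [← zpow_neg]; exact hUs _) (by simpa using hTs 1)
    (by simpa using hTs (-1)) (by
      rintro _ ⟨k, n, l, hn, rfl⟩
      have hT1 (x : H) := translation_dilation_orbit hTD 1 hn l x
      rw [zpow_one] at hT1
      rw [hshift, hT1, hT1, hshift])
  refine coreEquivalent_of_unitary R (fun x => ?_) hRT
  rw [(hW i).mem_coreSpace_iff, (hW j).mem_coreSpace_iff]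
  refine forall₂_congr fun n l => imp_congr_right fun hn => ?_
  have hgen := hRs _ ⟨i, n, l, hn, rfl⟩
  rw [hshift, sub_add_cancel] at hgen
  rw [← hgen, Unitary.inner_map_map]

/-- If all integer powers of a unitary `U` lie in `C_ψ(D,T)`, then every `Uⁱψ` is a
wavelet and the wavelets `Uⁱψ, i ∈ ℤ`, are pairwise core equivalent. -/
theorem stmt_1
    (D T : unitary B)
    (hD : ∀ f : H, ⇑((D : B) f) =ᵐ[MeasureTheory.volume]
      fun x : ℝ => (Real.sqrt 2 : ℂ) * f (2 * x))
    (hT : ∀ f : H, ⇑((T : B) f) =ᵐ[MeasureTheory.volume] fun x : ℝ => f (x + 1))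
    (ψ : H) (hψ : IsWavelet D T ψ)
    (U : unitary B)
    (hU : ∀ n : ℤ, ((U ^ n : unitary B) : B) ∈ localCommutant D T ψ) :
    (∀ i : ℤ, IsWavelet D T (((U ^ i : unitary B) : B) ψ)) ∧
    (∀ i j : ℤ, CoreEquivalent D T (((U ^ i : unitary B) : B) ψ)
      (((U ^ j : unitary B) : B) ψ)) := by
  have hW (i : ℤ) : IsWavelet D T (((U ^ i : unitary B) : B) ψ) :=
    hψ.map_of_mem_localCommutant (U ^ i) (hU i)
  exact ⟨hW, coreEquivalent_zpow (translation_dilation hD hT) hU hW⟩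

end
end

section
/- Let ψ be a wavelet in L²(ℝ), let U be a unitary operator on L²(ℝ) with Uⁿ ∈ C_ψ(D,T) for all n ∈ ℤ, set ψ⁽ⁱ⁾ = U^i ψ with core space V₀⁽ⁱ⁾, and let Y be the closed linear span of the union over i ∈ ℤ of the orthogonal complements (V₀⁽ⁱ⁾)^⊥. Then for every x ∈ Y and all i, n ∈ ℤ one has U^i Tⁿ x = Tⁿ U^i x. -/
open MeasureTheory
open scoped ComplexInnerProductSpace

noncomputable section

/-- A vector orthogonal to those members of a Hilbert basis whose index is outside `S` lies in
every closed submodule containing the members indexed by `S`. -/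
theorem mem_of_orthonormal_of_inner_eq_zero {ι E : Type*} [NormedAddCommGroup E]
    [InnerProductSpace ℂ E] [CompleteSpace E] {v : ι → E} (hv : Orthonormal ℂ v)
    (hsp : (Submodule.span ℂ (Set.range v)).topologicalClosure = ⊤) {S : Set ι}
    {K : Submodule ℂ E} (hK : IsClosed (K : Set E)) (hvK : ∀ i ∈ S, v i ∈ K) {x : E}
    (hx : ∀ i ∉ S, inner ℂ (v i) x = 0) : x ∈ K := by
  let b := HilbertBasis.mk hv hsp.ge
  refine hK.mem_of_tendsto (b.hasSum_repr x) (.of_forall fun s => ?_)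
  refine K.sum_mem fun i _ => ?_
  rw [b.repr_apply_apply, HilbertBasis.coe_mk]
  by_cases hi : i ∈ S
  · exact K.smul_mem _ (hvK i hi)
  · simp [hx i hi]

theorem quasiMeasurePreserving_two_mul :
    Measure.QuasiMeasurePreserving (fun x : ℝ => 2 * x) volume volume := by
  refine ⟨by fun_prop, ?_⟩
  rw [Real.map_volume_mul_left two_ne_zero]
  exact Measure.smul_absolutelyContinuous

theorem translation_mul_dilation (D T : unitary B)
    (hD : ∀ f : H, ⇑((D : B) f) =ᵐ[volume] fun x : ℝ => (Real.sqrt 2 : ℂ) * f (2 * x))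
    (hT : ∀ f : H, ⇑((T : B) f) =ᵐ[volume] fun x : ℝ => f (x + 1)) :
    T * D = D * T ^ 2 := by
  have hshift := (measurePreserving_add_right volume (1 : ℝ)).quasiMeasurePreserving
  ext f : 2
  apply Lp.ext
  change ⇑((T : B) ((D : B) f)) =ᵐ[volume] ⇑((D : B) (((T ^ 2 : unitary B) : B) f))
  have hTT : ⇑(((T ^ 2 : unitary B) : B) f) =ᵐ[volume] fun x : ℝ => f (x + 1 + 1) := by
    rw [pow_two]
    exact (hT ((T : B) f)).trans (hshift.ae (hT f))
  filter_upwards [hT ((D : B) f), hshift.ae (hD f), hD (((T ^ 2 : unitary B) : B) f),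
    quasiMeasurePreserving_two_mul.ae hTT] with x h₁ h₂ h₃ h₄
  rw [h₁, h₂, h₃, h₄]
  ring_nf

theorem zpow_mul_pow_eq_of_mul_eq {G : Type*} [Group G] {D T : G} (h : T * D = D * T ^ 2)
    (n : ℤ) (k : ℕ) : T ^ n * D ^ k = D ^ k * T ^ (n * 2 ^ k) := by
  have hconj : SemiconjBy D (T ^ (2 : ℤ)) T := by
    rw [SemiconjBy, h, zpow_ofNat]
  induction k generalizing n with
  | zero => simp
  | succ k ih =>
    have hn : D * T ^ (2 * n) = T ^ n * D := by
      rw [zpow_mul]; exact (hconj.zpow_right n).eq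
    rw [pow_succ', ← mul_assoc, ← hn, mul_assoc, ih, ← mul_assoc,
      show 2 * n * 2 ^ k = n * 2 ^ (k + 1) by ring]

/-- Operators all of whose powers are in the local commutant of `ψ` are in that of every `Uʲψ`. -/
theorem zpow_mem_localCommutant {D T U : unitary B} {ψ : H}
    (hU : ∀ n : ℤ, ((U ^ n : unitary B) : B) ∈ localCommutant D T ψ) (i j : ℤ) :
    ((U ^ i : unitary B) : B) ∈ localCommutant D T (((U ^ j : unitary B) : B) ψ) := by
  intro n l
  have hij (y : H) : ((U ^ i : unitary B) : B) (((U ^ j : unitary B) : B) y) =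
      ((U ^ (i + j) : unitary B) : B) y := by
    rw [zpow_add]; rfl
  rw [← hU j n l, hij, hij, hU (i + j) n l]

theorem isWavelet_of_mem_localCommutant {D T V : unitary B} {ψ : H} (hψ : IsWavelet D T ψ)
    (hV : (V : B) ∈ localCommutant D T ψ) : IsWavelet D T ((V : B) ψ) := by
  let e : H ≃ₗᵢ[ℂ] H := Unitary.linearIsometryEquiv V
  have he : (fun p : ℤ × ℤ => ((D ^ p.1 : unitary B) : B) (((T ^ p.2 : unitary B) : B)
      ((V : B) ψ))) = e ∘ fun p : ℤ × ℤ =>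
        ((D ^ p.1 : unitary B) : B) (((T ^ p.2 : unitary B) : B) ψ) :=
    funext fun p => (hV p.1 p.2).symm
  refine ⟨he ▸ hψ.1.comp_linearIsometryEquiv e, ?_⟩
  have hd := Submodule.dense_iff_topologicalClosure_eq_top.mpr hψ.2
  rw [← Submodule.dense_iff_topologicalClosure_eq_top, he, Set.range_comp]
  have hspan := congrArg (fun N : Submodule ℂ H => (N : Set H))
    (Submodule.span_image e.toLinearEquiv.toLinearMap
      (s := Set.range fun p : ℤ × ℤ => ((D ^ p.1 : unitary B) : B) (((T ^ p.2 : unitary B) : B) ψ)))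
  exact (e.surjective.denseRange.dense_image e.continuous hd).mono hspan.ge

/-- The commutation holds on the orthogonal complement of the core space of a wavelet. -/
theorem zpow_commute_of_mem_coreSpace_orthogonal {D T : unitary B} {η : H} {V : B}
    (hTD : T * D = D * T ^ 2) (hη : IsWavelet D T η) (hV : V ∈ localCommutant D T η) (n : ℤ)
    {x : H} (hx : x ∈ (coreSpace D T η)ᗮ) :
    V (((T ^ n : unitary B) : B) x) = ((T ^ n : unitary B) : B) (V x) := by
  refine mem_of_orthonormal_of_inner_eq_zero hη.1 hη.2 (S := {p | 0 ≤ p.1})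
    (K := LinearMap.eqLocus (V ∘L ((T ^ n : unitary B) : B)).toLinearMap
      (((T ^ n : unitary B) : B) ∘L V).toLinearMap) (isClosed_eq (V ∘L _).continuous (_ ∘L V).continuous) ?_ ?_
  · rintro ⟨k, l⟩ hk
    lift k to ℕ using hk
    have hcomm (y : H) : ((T ^ n : unitary B) : B) (((D ^ (k : ℤ) : unitary B) : B)
        (((T ^ l : unitary B) : B) y)) = ((D ^ (k : ℤ) : unitary B) : B)
          (((T ^ (n * 2 ^ k + l) : unitary B) : B) y) := by
      have h : T ^ n * (D ^ (k : ℤ) * T ^ l) = D ^ (k : ℤ) * T ^ (n * 2 ^ k + l) := by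
        rw [zpow_natCast, ← mul_assoc, zpow_mul_pow_eq_of_mul_eq hTD, mul_assoc, zpow_add]
      exact congrArg (fun W : unitary B => (W : B) y) h
    change V (((T ^ n : unitary B) : B) _) = ((T ^ n : unitary B) : B) (V _)
    rw [hV, hcomm, hcomm, hV]
  · rintro ⟨k, l⟩ hk
    exact hx _ (Submodule.le_topologicalClosure _
      (Submodule.subset_span ⟨k, l, not_le.mp hk, rfl⟩))

/-- If all integer powers of `U` lie in `C_ψ(D,T)` and `Y` is the closed span of the
union of the orthogonal complements of the core spaces of the wavelets `Uⁱψ`, then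
`Uⁱ` and `Tⁿ` commute on `Y`. -/
theorem stmt_2
    (D T : unitary B)
    (hD : ∀ f : H, ⇑((D : B) f) =ᵐ[MeasureTheory.volume]
      fun x : ℝ => (Real.sqrt 2 : ℂ) * f (2 * x))
    (hT : ∀ f : H, ⇑((T : B) f) =ᵐ[MeasureTheory.volume] fun x : ℝ => f (x + 1))
    (ψ : H) (hψ : IsWavelet D T ψ)
    (U : unitary B)
    (hU : ∀ n : ℤ, ((U ^ n : unitary B) : B) ∈ localCommutant D T ψ)
    (Y : Submodule ℂ H)
    (hY : Y = (Submodule.span ℂ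
      (⋃ i : ℤ, ((coreSpace D T (((U ^ i : unitary B) : B) ψ))ᗮ : Set H))).topologicalClosure) :
    ∀ x ∈ Y, ∀ i n : ℤ,
      ((U ^ i : unitary B) : B) (((T ^ n : unitary B) : B) x) =
        ((T ^ n : unitary B) : B) (((U ^ i : unitary B) : B) x) := by
  subst hY
  intro x hx i n
  have hTD := translation_mul_dilation D T hD hT
  refine Submodule.topologicalClosure_minimal _
    (t := LinearMap.eqLocus (((U ^ i : unitary B) : B) ∘L ((T ^ n : unitary B) : B)).toLinearMap
      (((T ^ n : unitary B) : B) ∘L ((U ^ i : unitary B) : B)).toLinearMap)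
    (Submodule.span_le.mpr (Set.iUnion_subset fun j y hy => ?_))
    (isClosed_eq (ContinuousLinearMap.continuous (_ ∘L _))
      (ContinuousLinearMap.continuous (_ ∘L _))) hx
  exact zpow_commute_of_mem_coreSpace_orthogonal hTD
    (isWavelet_of_mem_localCommutant hψ (hU j)) (zpow_mem_localCommutant hU i j) n hy

end
end

section
/- Let ψ be a wavelet in L²(ℝ), let U ∈ C_ψ(D,T) be a unitary operator, and set η = Uψ (a wavelet). Then U maps the core space of ψ unitarily onto the core space of η: U(V₀^ψ) = V₀^η. -/
open MeasureTheory
open scoped ComplexInnerProductSpace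

noncomputable section

/-- A unitary operator commutes with taking closures of subspaces. -/
lemma map_topologicalClosure_of_unitary (U : unitary B) (S : Submodule ℂ H) :
    S.topologicalClosure.map ((U : B) : H →ₗ[ℂ] H) =
      (S.map ((U : B) : H →ₗ[ℂ] H)).topologicalClosure :=
  SetLike.coe_injective
    ((Unitary.linearIsometryEquiv U).toContinuousLinearEquiv.image_closure (S : Set H))

/-- A unitary `U ∈ C_ψ(D,T)` maps the core space of `ψ` onto the core space of `η = Uψ`. -/
theorem stmt_3
    (D T : unitary B)
    (hD : ∀ f : H, ⇑((D : B) f) =ᵐ[MeasureTheory.volume]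
      fun x : ℝ => (Real.sqrt 2 : ℂ) * f (2 * x))
    (hT : ∀ f : H, ⇑((T : B) f) =ᵐ[MeasureTheory.volume] fun x : ℝ => f (x + 1))
    (ψ : H) (hψ : IsWavelet D T ψ)
    (U : unitary B) (hU : (U : B) ∈ localCommutant D T ψ)
    (η : H) (hη : η = (U : B) ψ) :
    (coreSpace D T ψ).map ((U : B) : H →ₗ[ℂ] H) = coreSpace D T η := by
  have map_generators : (U : B) '' {x : H | ∃ n l : ℤ, n < 0 ∧
        x = ((D ^ n : unitary B) : B) (((T ^ l : unitary B) : B) ψ)} =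
      {x : H | ∃ n l : ℤ, n < 0 ∧
        x = ((D ^ n : unitary B) : B) (((T ^ l : unitary B) : B) η)} := by
    subst hη
    ext y
    constructor
    · rintro ⟨_, ⟨n, l, hn, rfl⟩, rfl⟩
      exact ⟨n, l, hn, hU n l⟩
    · rintro ⟨n, l, hn, rfl⟩
      exact ⟨_, ⟨n, l, hn, rfl⟩, hU n l⟩
  rw [coreSpace, coreSpace, ← map_generators, map_topologicalClosure_of_unitary]
  congr 1
  exact Submodule.map_span ((U : B) : H →ₗ[ℂ] H) _

end
end

section
/- Let W = [-π/4, -π/8) ∪ [15π/8, 15π/4) ⊆ ℝ. Then: (i) the 2π-translates of W tile ℝ, i.e. Σ_{k∈ℤ} 1_W(ξ + 2πk) = 1 for almost every ξ ∈ ℝ; and (ii) the dyadic dilates of W tile ℝ, i.e. Σ_{j∈ℤ} 1_W(2^j ξ) = 1 for almost every ξ ∈ ℝ. (Hence W is a wavelet set.) -/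
open MeasureTheory Set
open scoped Real

noncomputable section

lemma tsum_indicator_one_eq_one {ι α : Type*} {W : Set α} {f : ι → α}
    (h : ∃! i, f i ∈ W) : ∑' i, W.indicator (1 : α → ℝ) (f i) = 1 := by
  obtain ⟨i, hi, hu⟩ := h
  rw [tsum_eq_single i fun j hj => indicator_of_notMem (fun hm => hj (hu j hm)) _]
  simp [indicator_of_mem hi]

lemma two_mul_zpow_le_of_lt {m n : ℤ} (h : m < n) : 2 * (2 : ℝ) ^ m ≤ 2 ^ n := by
  rw [← zpow_one_add₀ two_ne_zero]
  exact zpow_le_zpow_right₀ one_le_two (by lia)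

lemma existsUnique_two_zpow_mul_mem_Ico {a x : ℝ} (ha : 0 < a) (hx : 0 < x) :
    ∃! j : ℤ, (2 : ℝ) ^ j * x ∈ Ico a (2 * a) := by
  obtain ⟨n, h₁, h₂⟩ := exists_mem_Ico_zpow (div_pos hx ha) (one_lt_two : (1 : ℝ) < 2)
  have hn : (0 : ℝ) < 2 ^ n := by positivity
  rw [zpow_add_one₀ two_ne_zero, div_lt_iff₀ ha] at h₂
  rw [le_div_iff₀ ha] at h₁
  refine existsUnique_of_exists_of_unique ⟨-n, ?_, ?_⟩ ?_
  · rw [zpow_neg, inv_mul_eq_div, le_div_iff₀ hn]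
    linarith
  · rw [zpow_neg, inv_mul_eq_div, div_lt_iff₀ hn]
    linarith
  · rintro i j ⟨hi₁, hi₂⟩ ⟨hj₁, hj₂⟩
    rcases lt_trichotomy i j with h | h | h
    · nlinarith [two_mul_zpow_le_of_lt h]
    · exact h
    · nlinarith [two_mul_zpow_le_of_lt h]

lemma existsUnique_two_zpow_mul_mem_Ioc {a x : ℝ} (ha : 0 < a) (hx : 0 < x) :
    ∃! j : ℤ, (2 : ℝ) ^ j * x ∈ Ioc a (2 * a) := by
  obtain ⟨n, h₁, h₂⟩ := exists_mem_Ioc_zpow (div_pos hx ha) (one_lt_two : (1 : ℝ) < 2)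
  have hn : (0 : ℝ) < 2 ^ n := by positivity
  rw [zpow_add_one₀ two_ne_zero, div_le_iff₀ ha] at h₂
  rw [lt_div_iff₀ ha] at h₁
  refine existsUnique_of_exists_of_unique ⟨-n, ?_, ?_⟩ ?_
  · rw [zpow_neg, inv_mul_eq_div, lt_div_iff₀ hn]
    linarith
  · rw [zpow_neg, inv_mul_eq_div, div_le_iff₀ hn]
    linarith
  · rintro i j ⟨hi₁, hi₂⟩ ⟨hj₁, hj₂⟩
    rcases lt_trichotomy i j with h | h | h
    · nlinarith [two_mul_zpow_le_of_lt h]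
    · exact h
    · nlinarith [two_mul_zpow_le_of_lt h]

/-- The set `W = [-π/4, -π/8) ∪ [15π/8, 15π/4)` tiles `ℝ` both by `2π`-translations
and by dyadic dilations (hence `W` is a wavelet set). -/
theorem stmt_12
    (W : Set ℝ)
    (hW : W = Set.Ico (-(π / 4)) (-(π / 8)) ∪ Set.Ico (15 * π / 8) (15 * π / 4)) :
    (∀ᵐ ξ : ℝ ∂MeasureTheory.volume,
      (∑' k : ℤ, W.indicator (1 : ℝ → ℝ) (ξ + 2 * π * k)) = 1) ∧
    (∀ᵐ ξ : ℝ ∂MeasureTheory.volume,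
      (∑' j : ℤ, W.indicator (1 : ℝ → ℝ) ((2 : ℝ) ^ j * ξ)) = 1) := by
  have hπ := Real.pi_pos
  subst hW
  constructor
  · refine Filter.Eventually.of_forall fun ξ => tsum_indicator_one_eq_one ?_
    obtain ⟨k, ⟨h₁, h₂⟩, hu⟩ := existsUnique_add_zsmul_mem_Ico Real.two_pi_pos ξ (-(π / 4))
    simp only [zsmul_eq_mul, mem_Ico] at h₁ h₂ hu
    have key : ∀ m : ℤ, ξ + 2 * π * m ∈ Ico (-(π / 4)) (-(π / 8)) ∪
        Ico (15 * π / 8) (15 * π / 4) →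
        m = k ∧ ξ + 2 * π * k < -(π / 8) ∨ m = k + 1 ∧ -(π / 8) ≤ ξ + 2 * π * k := by
      rintro m (⟨ha, hb⟩ | ⟨ha, hb⟩)
      · obtain rfl := hu m ⟨by linarith, by linarith⟩
        exact .inl ⟨rfl, hb⟩
      · have hm := hu (m - 1) ⟨by push_cast; linarith, by push_cast; linarith⟩
        obtain rfl : m = k + 1 := by lia
        push_cast at ha
        exact .inr ⟨rfl, by linarith⟩
    refine existsUnique_of_exists_of_unique ?_ fun i j hi hj => ?_
    · rcases lt_or_ge (ξ + 2 * π * k) (-(π / 8)) with h | h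
      · exact ⟨k, .inl ⟨by linarith, h⟩⟩
      · exact ⟨k + 1, .inr ⟨by push_cast; linarith, by push_cast; linarith⟩⟩
    · rcases key i hi with ⟨hi, h⟩ | ⟨hi, h⟩ <;> rcases key j hj with ⟨hj, h'⟩ | ⟨hj, h'⟩ <;>
        first | lia | linarith
  · filter_upwards [Measure.ae_ne volume (0 : ℝ)] with ξ hξ
    refine tsum_indicator_one_eq_one ?_
    rcases lt_or_gt_of_ne hξ with h | h
    · refine (existsUnique_congr fun j => ?_).mp
        (existsUnique_two_zpow_mul_mem_Ioc (a := π / 8) (by positivity) (neg_pos.mpr h))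
      have hneg : (2 : ℝ) ^ j * ξ < 0 := mul_neg_of_pos_of_neg (by positivity) h
      simp only [mem_union, mem_Ico, mem_Ioc, mul_neg]
      constructor
      · rintro ⟨h₁, h₂⟩
        exact .inl ⟨by linarith, by linarith⟩
      · rintro (⟨h₁, h₂⟩ | ⟨h₁, h₂⟩) <;> constructor <;> linarith
    · refine (existsUnique_congr fun j => ?_).mp
        (existsUnique_two_zpow_mul_mem_Ico (a := 15 * π / 8) (by positivity) h)
      have hpos : 0 < (2 : ℝ) ^ j * ξ := by positivity
      simp only [mem_union, mem_Ico]
      constructor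
      · rintro ⟨h₁, h₂⟩
        exact .inr ⟨by linarith, by linarith⟩
      · rintro (⟨h₁, h₂⟩ | ⟨h₁, h₂⟩) <;> constructor <;> linarith

end
end

section
/- Let W₁ = [-π/4, -π/8) ∪ [15π/8, 15π/4) and define σ : W₁ → ℝ by σ(ξ) = ξ − 2π for ξ ∈ [-π/4, -π/8) ∪ [17π/8, 9π/4), σ(ξ) = ξ − 4π for ξ ∈ [15π/8, 17π/8), and σ(ξ) = ξ − 6π for ξ ∈ [9π/4, 15π/4). Then σ(ξ) − ξ ∈ 2πℤ for every ξ ∈ W₁, and σ is a bijection from W₁ onto [−15π/4, −15π/8) ∪ [π/8, π/4), a set that coincides with −W₁ up to a Lebesgue-null set. -/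
open MeasureTheory Set
open scoped Real

noncomputable section

/-- The map `σ` on `W₁ = [-π/4, -π/8) ∪ [15π/8, 15π/4)` given piecewise by translations
by `-2π`, `-4π`, `-6π` is effected by `2π`-translations and is a bijection of `W₁` onto
`[-15π/4, -15π/8) ∪ [π/8, π/4)`, a set coinciding with `-W₁` up to a Lebesgue-null set. -/
theorem stmt_13
    (W₁ : Set ℝ)
    (hW₁ : W₁ = Set.Ico (-(π / 4)) (-(π / 8)) ∪ Set.Ico (15 * π / 8) (15 * π / 4))
    (σ : ℝ → ℝ)
    (hσ1 : ∀ ξ ∈ Set.Ico (-(π / 4)) (-(π / 8)) ∪ Set.Ico (17 * π / 8) (9 * π / 4),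
      σ ξ = ξ - 2 * π)
    (hσ2 : ∀ ξ ∈ Set.Ico (15 * π / 8) (17 * π / 8), σ ξ = ξ - 4 * π)
    (hσ3 : ∀ ξ ∈ Set.Ico (9 * π / 4) (15 * π / 4), σ ξ = ξ - 6 * π) :
    (∀ ξ ∈ W₁, ∃ k : ℤ, σ ξ - ξ = 2 * π * k) ∧
    Set.BijOn σ W₁ (Set.Ico (-(15 * π / 4)) (-(15 * π / 8)) ∪ Set.Ico (π / 8) (π / 4)) ∧
    MeasureTheory.volume
      (symmDiff (Set.Ico (-(15 * π / 4)) (-(15 * π / 8)) ∪ Set.Ico (π / 8) (π / 4))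
        (-W₁)) = 0 := by
  have hπ := Real.pi_pos
  have pieces : ∀ ξ ∈ W₁,
      (ξ ∈ Ico (-(π / 4)) (-(π / 8)) ∧ σ ξ = ξ - 2 * π) ∨
      (ξ ∈ Ico (15 * π / 8) (17 * π / 8) ∧ σ ξ = ξ - 4 * π) ∨
      (ξ ∈ Ico (17 * π / 8) (9 * π / 4) ∧ σ ξ = ξ - 2 * π) ∨
      (ξ ∈ Ico (9 * π / 4) (15 * π / 4) ∧ σ ξ = ξ - 6 * π) := by
    intro ξ hξ
    rw [hW₁] at hξ
    rcases hξ with h | h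
    · exact Or.inl ⟨h, hσ1 ξ (Or.inl h)⟩
    · rcases lt_or_ge ξ (17 * π / 8) with h1 | h1
      · exact Or.inr (Or.inl ⟨⟨h.1, h1⟩, hσ2 ξ ⟨h.1, h1⟩⟩)
      · rcases lt_or_ge ξ (9 * π / 4) with h2 | h2
        · exact Or.inr (Or.inr (Or.inl ⟨⟨h1, h2⟩, hσ1 ξ (Or.inr ⟨h1, h2⟩)⟩))
        · exact Or.inr (Or.inr (Or.inr ⟨⟨h2, h.2⟩, hσ3 ξ ⟨h2, h.2⟩⟩))
  refine ⟨fun ξ hξ => ?_, ⟨fun ξ hξ => ?_, fun ξ hξ η hη h => ?_, fun y hy => ?_⟩, ?_⟩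
  · rcases pieces ξ hξ with ⟨-, e⟩ | ⟨-, e⟩ | ⟨-, e⟩ | ⟨-, e⟩
    · exact ⟨-1, by rw [e]; push_cast; ring⟩
    · exact ⟨-2, by rw [e]; push_cast; ring⟩
    · exact ⟨-1, by rw [e]; push_cast; ring⟩
    · exact ⟨-3, by rw [e]; push_cast; ring⟩
  · rcases pieces ξ hξ with ⟨⟨h1, h2⟩, e⟩ | ⟨⟨h1, h2⟩, e⟩ | ⟨⟨h1, h2⟩, e⟩ | ⟨⟨h1, h2⟩, e⟩
    · exact Or.inl ⟨by linarith, by linarith⟩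
    · exact Or.inl ⟨by linarith, by linarith⟩
    · exact Or.inr ⟨by linarith, by linarith⟩
    · exact Or.inl ⟨by linarith, by linarith⟩
  · rcases pieces ξ hξ with ⟨⟨h1, h2⟩, e⟩ | ⟨⟨h1, h2⟩, e⟩ | ⟨⟨h1, h2⟩, e⟩ | ⟨⟨h1, h2⟩, e⟩ <;>
    rcases pieces η hη with ⟨⟨k1, k2⟩, f⟩ | ⟨⟨k1, k2⟩, f⟩ | ⟨⟨k1, k2⟩, f⟩ | ⟨⟨k1, k2⟩, f⟩ <;>
    linarith
  · subst hW₁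
    rcases hy with ⟨h1, h2⟩ | ⟨h1, h2⟩
    · rcases lt_or_ge y (-(9 * π / 4)) with h3 | h3
      · exact ⟨y + 6 * π, Or.inr ⟨by linarith, by linarith⟩, by
          rw [hσ3 _ ⟨by linarith, by linarith⟩]; ring⟩
      · rcases lt_or_ge y (-(17 * π / 8)) with h4 | h4
        · exact ⟨y + 2 * π, Or.inl ⟨by linarith, by linarith⟩, by
            rw [hσ1 _ (Or.inl ⟨by linarith, by linarith⟩)]; ring⟩
        · exact ⟨y + 4 * π, Or.inr ⟨by linarith, by linarith⟩, by
            rw [hσ2 _ ⟨by linarith, by linarith⟩]; ring⟩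
    · exact ⟨y + 2 * π, Or.inr ⟨by linarith, by linarith⟩, by
        rw [hσ1 _ (Or.inr ⟨by linarith, by linarith⟩)]; ring⟩
  · rw [measure_symmDiff_eq_zero_iff, hW₁, Set.union_neg, Set.neg_Ico, Set.neg_Ico, neg_neg,
      neg_neg, Set.union_comm (Ioc _ _)]
    exact Ico_ae_eq_Ioc.union Ico_ae_eq_Ioc

end
end

section
/- Let W₁ = [-π/4, -π/8) ∪ [15π/8, 15π/4) and define σ : W₁ → ℝ by σ(ξ) = ξ − 2π for ξ ∈ [-π/4, -π/8) ∪ [17π/8, 9π/4), σ(ξ) = ξ − 4π for ξ ∈ [15π/8, 17π/8), and σ(ξ) = ξ − 6π for ξ ∈ [9π/4, 15π/4); extend σ to a map on ℝ∖{0} by σ(x) = 2^{-n} σ(2^n x) whenever 2^n x ∈ W₁ for n ∈ ℤ. Then for every ξ ∈ A = [17π/8, 273π/128): σ(ξ) = ξ − 2π; 16(ξ − 2π) ∈ [2π, 17π/8) ⊆ W₁; σ(ξ − 2π) = (ξ − 2π) − π/4; and hence σ(σ(ξ)) = ξ − 9π/4. In particular, σ∘σ(ξ) − ξ = −9π/4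 ∉ 2πℤ for every ξ in the positive-measure set A ⊆ W₁, so the restriction of σ² to W₁ is not effected by 2π translations. -/
open MeasureTheory Set
open scoped Real

noncomputable section

/-- With `σ` as in the counterexample (defined piecewise on
`W₁ = [-π/4, -π/8) ∪ [15π/8, 15π/4)` and extended by `σ(x) = 2^{-n} σ(2^n x)` whenever
`2^n x ∈ W₁`): on `A = [17π/8, 273π/128) ⊆ W₁`, a set of positive measure, one has
`σ(ξ) = ξ - 2π`, `16(ξ - 2π) ∈ [2π, 17π/8) ⊆ W₁`, `σ(ξ - 2π) = (ξ - 2π) - π/4`, hence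
`σ(σ(ξ)) = ξ - 9π/4` and `σ∘σ(ξ) - ξ ∉ 2πℤ`; so `σ²|_{W₁}` is not effected by
`2π`-translations. -/
theorem stmt_14
    (W₁ : Set ℝ)
    (hW₁ : W₁ = Set.Ico (-(π / 4)) (-(π / 8)) ∪ Set.Ico (15 * π / 8) (15 * π / 4))
    (σ : ℝ → ℝ)
    (hσ1 : ∀ ξ ∈ Set.Ico (-(π / 4)) (-(π / 8)) ∪ Set.Ico (17 * π / 8) (9 * π / 4),
      σ ξ = ξ - 2 * π)
    (hσ2 : ∀ ξ ∈ Set.Ico (15 * π / 8) (17 * π / 8), σ ξ = ξ - 4 * π)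
    (hσ3 : ∀ ξ ∈ Set.Ico (9 * π / 4) (15 * π / 4), σ ξ = ξ - 6 * π)
    (hext : ∀ (x : ℝ) (n : ℤ), (2 : ℝ) ^ n * x ∈ W₁ →
      σ x = (2 : ℝ) ^ (-n) * σ ((2 : ℝ) ^ n * x))
    (A : Set ℝ) (hA : A = Set.Ico (17 * π / 8) (273 * π / 128)) :
    A ⊆ W₁ ∧ 0 < MeasureTheory.volume A ∧
    ∀ ξ ∈ A,
      σ ξ = ξ - 2 * π ∧
      16 * (ξ - 2 * π) ∈ Set.Ico (2 * π) (17 * π / 8) ∧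
      Set.Ico (2 * π) (17 * π / 8) ⊆ W₁ ∧
      σ (ξ - 2 * π) = (ξ - 2 * π) - π / 4 ∧
      σ (σ ξ) = ξ - 9 * π / 4 ∧
      ¬ ∃ k : ℤ, σ (σ ξ) - ξ = 2 * π * k := by
  have hπ := Real.pi_pos
  subst hW₁ hA
  refine ⟨?_, ?_, ?_⟩
  · rintro ξ ⟨h₁, h₂⟩
    exact Or.inr ⟨by linarith, by linarith⟩
  · rw [Real.volume_Ico, ENNReal.ofReal_pos]
    linarith
  rintro ξ ⟨h₁, h₂⟩
  have hσξ : σ ξ = ξ - 2 * π := hσ1 ξ (Or.inr ⟨by linarith, by linarith⟩)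
  have hmem : 16 * (ξ - 2 * π) ∈ Set.Ico (2 * π) (17 * π / 8) :=
    ⟨by linarith, by linarith⟩
  have hsub : Set.Ico (2 * π) (17 * π / 8) ⊆
      Set.Ico (-(π / 4)) (-(π / 8)) ∪ Set.Ico (15 * π / 8) (15 * π / 4) :=
    fun x hx => Or.inr ⟨by linarith [hx.1], by linarith [hx.2]⟩
  have hpow : (2 : ℝ) ^ (4 : ℤ) = 16 := by norm_num
  have hσσ : σ (ξ - 2 * π) = (ξ - 2 * π) - π / 4 := by
    rw [hext (ξ - 2 * π) 4 (by rw [hpow]; exact hsub hmem), zpow_neg, hpow,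
      hσ2 _ ⟨by linarith [hmem.1], hmem.2⟩]
    ring
  have hσ2ξ : σ (σ ξ) = ξ - 9 * π / 4 := by
    rw [hσξ, hσσ]
    ring
  refine ⟨hσξ, hmem, hsub, hσσ, hσ2ξ, ?_⟩
  rintro ⟨k, hk⟩
  have hk' : (8 * k : ℝ) = -9 := by
    apply mul_right_cancel₀ hπ.ne'
    linarith
  have hk'' : 8 * k = -9 := by exact_mod_cast hk'
  omega

end
end
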